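/- arXiv:2401.06932 — 2 statements merged into one kernel-verified Lean document; each statement's English description precedes it below -/
import Mathlib

section
/- Let G be a finite alphabet with involution, let L be a Pythagorean language over G, and let d, n ≥ 1. For each a ∈ G let X_a be a d×d complex matrix satisfying X_{a*} = (X_a)ᴴ (conjugate transpose). Then the d×d matrix Σ_{w ∈ L, |w| = 2n} X_{w₁} X_{w₂} ⋯ X_{w_{2n}}, where the sum runs over all words of L of length 2n, is positive semidefinite. -/
open Matrix ComplexOrder

/-- The involution on words induced by an involution `s` on letters:
`(a₁a₂⋯a_g)* = a_g*⋯a₂*a₁*`. -/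
def wordStar {G : Type*} (s : G → G) (w : List G) : List G :=
  (w.map s).reverse

/-- A language is self-adjoint if it is closed under the word involution. -/
def IsSelfAdjointLang {G : Type*} (s : G → G) (L : Set (List G)) : Prop :=
  ∀ w ∈ L, wordStar s w ∈ L

/-- A self-adjoint language `L` is Pythagorean if for all nonempty words `α, β, γ`:
whenever `β*α` and `γ*α` lie in `L`, then `α*α` and `γ*β` lie in `L`. -/
def IsPythagorean {G : Type*} (s : G → G) (L : Set (List G)) : Prop :=
  IsSelfAdjointLang s L ∧
    ∀ α β γ : List G, α ≠ [] → β ≠ [] → γ ≠ [] →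
      wordStar s β ++ α ∈ L → wordStar s γ ++ α ∈ L →
      wordStar s α ++ α ∈ L ∧ wordStar s γ ++ β ∈ L

open Classical in
/-- A sum of products `(A u)ᴴ * A v` over the pairs of a partial equivalence relation is
positive semidefinite. -/
theorem posSemidef_sum_of_symm_trans {ι m : Type*} [Fintype ι] [Fintype m]
    (r : ι → ι → Prop) (hsymm : ∀ u v, r u v → r v u)
    (htrans : ∀ u v w, r u v → r v w → r u w) (A : ι → Matrix m m ℂ) :
    (∑ u, ∑ v, if r u v then (A u)ᴴ * A v else 0).PosSemidef := by
  have hr : ∀ u v, r u v ↔ r u u ∧ r v v ∧ {x | r u x} = {x | r v x} := by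
    intro u v
    constructor
    · intro h
      refine ⟨htrans _ _ _ h (hsymm _ _ h), htrans _ _ _ (hsymm _ _ h) h, ?_⟩
      ext x
      exact ⟨htrans _ _ _ (hsymm _ _ h), htrans _ _ _ h⟩
    · rintro ⟨-, hv, h⟩
      change v ∈ {x | r u x}
      rw [h]
      exact hv
  have key : (∑ u, ∑ v, if r u v then (A u)ᴴ * A v else 0) =
      ∑ c : Set ι, (∑ u, if r u u ∧ {x | r u x} = c then A u else 0)ᴴ *
        (∑ u, if r u u ∧ {x | r u x} = c then A u else 0) := by
    simp_rw [conjTranspose_sum, Finset.sum_mul_sum]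
    symm
    rw [Finset.sum_comm]
    refine Finset.sum_congr rfl fun u _ => ?_
    rw [Finset.sum_comm]
    refine Finset.sum_congr rfl fun v _ => ?_
    rw [Finset.sum_eq_single {x | r u x}]
    · by_cases hu : r u u <;> by_cases hv : r v v <;>
        simp [hr u v, hu, hv, eq_comm]
    · intro c _ hc
      simp [hc.symm]
    · simp
  rw [key]
  exact posSemidef_sum _ fun c _ => posSemidef_conjTranspose_mul_self _

theorem wordStar_append {G : Type*} (s : G → G) (u v : List G) :
    wordStar s (u ++ v) = wordStar s v ++ wordStar s u := by
  simp [wordStar]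

theorem wordStar_wordStar {G : Type*} {s : G → G} (hs : ∀ a, s (s a) = a) (u : List G) :
    wordStar s (wordStar s u) = u := by
  simp [wordStar, Function.comp_def, hs]

theorem prod_map_wordStar {G m : Type*} [Fintype m] [DecidableEq m] {s : G → G}
    {X : G → Matrix m m ℂ} (hX : ∀ a, X (s a) = (X a)ᴴ) (u : List G) :
    ((wordStar s u).map X).prod = ((u.map X).prod)ᴴ := by
  simp [wordStar, conjTranspose_list_prod, Function.comp_def, hX]

theorem wordStar_ofFn {G : Type*} (s : G → G) {n : ℕ} (u : Fin n → G) :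
    wordStar s (List.ofFn u) = List.ofFn fun i => s (u i.rev) := by
  apply List.ext_getElem
  · simp [wordStar]
  · intro i h₁ h₂
    simp [wordStar, Fin.rev]
    congr 2
    ext
    simp
    omega

/-- A sum over words of length `2 * n` splits as a double sum over words of length `n`. -/
theorem sum_ofFn_two_mul {G M : Type*} [Fintype G] [AddCommMonoid M] {s : G → G}
    (hs : ∀ a, s (s a) = a) (n : ℕ) (f : List G → M) :
    ∑ w : Fin (2 * n) → G, f (List.ofFn w) =
      ∑ u : Fin n → G, ∑ v : Fin n → G, f (wordStar s (List.ofFn u) ++ List.ofFn v) := by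
  have hinv : Function.Involutive fun (u : Fin n → G) i => s (u i.rev) := by
    intro u
    simp [hs]
  rw [two_mul, ← (Fin.appendEquiv n n).sum_comp, Fintype.sum_prod_type,
    ← Equiv.sum_comp (hinv.toPerm _)]
  simp [wordStar_ofFn, Fin.appendEquiv, List.ofFn_fin_append]

/-- For a Pythagorean language `L` over a finite alphabet and matrices `X_a` with
`X_{a*} = (X_a)ᴴ`, the sum `Σ_{w ∈ L, |w| = 2n} X_{w₁} ⋯ X_{w_{2n}}` is positive
semidefinite.  (The sum over all words of length `2n` in `L` is realized as the sum
over all functions `Fin (2n) → G`, with an indicator selecting the words of `L`.) -/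
theorem sum_words_posSemidef {G : Type*} [Fintype G] (s : G → G) (hs : ∀ a, s (s a) = a)
    (L : Set (List G)) (hL : IsPythagorean s L)
    (d n : ℕ) (hd : 1 ≤ d) (hn : 1 ≤ n)
    (X : G → Matrix (Fin d) (Fin d) ℂ) (hX : ∀ a, X (s a) = (X a)ᴴ) :
    (∑ w : Fin (2 * n) → G,
      Set.indicator L (fun v => (v.map X).prod) (List.ofFn w)).PosSemidef := by
  classical
  have hne : ∀ u : Fin n → G, List.ofFn u ≠ [] := by
    intro u h
    have := congrArg List.length h
    simp at this
    omega
  have hsymm : ∀ u v : List G, wordStar s u ++ v ∈ L → wordStar s v ++ u ∈ L := by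
    intro u v h
    simpa [wordStar_append, wordStar_wordStar hs] using hL.1 _ h
  rw [sum_ofFn_two_mul hs n]
  have key := posSemidef_sum_of_symm_trans
    (fun u v : Fin n → G => wordStar s (List.ofFn u) ++ List.ofFn v ∈ L)
    (fun u v h => hsymm _ _ h)
    (fun u v w huv hvw => (hL.2 _ _ _ (hne v) (hne w) (hne u) (hsymm _ _ hvw) huv).2)
    (fun u => ((List.ofFn u).map X).prod)
  convert key using 5 with u _ v
  rw [Set.indicator_apply, List.map_append, List.prod_append, prod_map_wordStar hX]
end

section
/- For every square complex matrix Z and every n ≥ 0, p_{n+1}(Z, Zᴴ) = Z · q_n(Z, Zᴴ) · Zᴴ, where q_n(Z, Zᴴ) is the sum over all Dyck words of length 2n of the corresponding products in Z and Zᴴ (with q_0 = 1, the identity matrix). This is the combinatorial form of the functional equation Y(Z) = Z (1 − Y(Z))^{-1} Zᴴ satisfied by Ando's unitarization function. -/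
open Matrix ComplexOrder

/-- The height of a word over `{u, d}` (with `u = true`, `d = false`):
`u` counts `+1`, `d` counts `-1`. -/
def ht (w : List Bool) : ℤ :=
  (w.map (fun b => if b then (1 : ℤ) else -1)).sum

/-- Irreducible Dyck words: nonempty words of total height `0` all of whose proper
nonempty prefixes have height `≥ 1`. -/
def IsIrrDyck (w : List Bool) : Prop :=
  w ≠ [] ∧ ht w = 0 ∧ ∀ p : List Bool, p <+: w → p ≠ [] → p ≠ w → 1 ≤ ht p

/-- `pMat Z n = p_n(Z, Zᴴ)`: the sum over all irreducible Dyck words of length `2n`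
of the corresponding products, where `u ↦ Z`, `d ↦ Zᴴ`. -/
noncomputable def pMat {d : ℕ} (Z : Matrix (Fin d) (Fin d) ℂ) (n : ℕ) :
    Matrix (Fin d) (Fin d) ℂ :=
  ∑ w : Fin (2 * n) → Bool,
    Set.indicator {v | IsIrrDyck v}
      (fun v => (v.map (fun b => if b then Z else Zᴴ)).prod) (List.ofFn w)

/-- Dyck words: words of total height `0` all of whose prefixes have height `≥ 0`
(the empty word is the unique Dyck word of length `0`). -/
def IsDyck (w : List Bool) : Prop :=
  ht w = 0 ∧ ∀ p : List Bool, p <+: w → 0 ≤ ht p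

/-- `qMat Z n = q_n(Z, Zᴴ)`: the sum over all Dyck words of length `2n` of the
corresponding products, where `u ↦ Z`, `d ↦ Zᴴ` (so `q_0 = 1`). -/
noncomputable def qMat {d : ℕ} (Z : Matrix (Fin d) (Fin d) ℂ) (n : ℕ) :
    Matrix (Fin d) (Fin d) ℂ :=
  ∑ w : Fin (2 * n) → Bool,
    Set.indicator {v | IsDyck v}
      (fun v => (v.map (fun b => if b then Z else Zᴴ)).prod) (List.ofFn w)

theorem ht_cons (b : Bool) (w : List Bool) : ht (b :: w) = (if b then 1 else -1) + ht w := by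
  simp [ht]

theorem ht_append (v w : List Bool) : ht (v ++ w) = ht v + ht w := by
  simp [ht]

/-- A word of length at least two is irreducible Dyck exactly when it is `u v d` with `v` Dyck. -/
theorem isIrrDyck_cons_append_singleton_iff (a b : Bool) (v : List Bool) :
    IsIrrDyck (a :: (v ++ [b])) ↔ a = true ∧ b = false ∧ IsDyck v := by
  constructor
  · rintro ⟨-, h0, h⟩
    have hp (p : List Bool) (hpv : p <+: v) : 1 ≤ ht (a :: p) := by
      refine h _ ?_ (by simp) ?_
      · exact (List.prefix_cons_inj a).2 (hpv.trans (List.prefix_append _ _))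
      · intro he
        have hlen := congrArg List.length he
        have := hpv.length_le
        simp at hlen
        omega
    have ha : a = true := by
      have := hp [] List.nil_prefix
      cases a <;> simp [ht] at this ⊢
    subst ha
    have hv := hp v (List.prefix_refl _)
    simp only [ht_cons, ht_append, if_true] at h0 hv hp
    cases b
    · simp only [Bool.false_eq_true, if_false, ht, List.map_nil, List.sum_nil] at h0
      refine ⟨rfl, rfl, ?_, fun p hpv => ?_⟩
      · simp only [ht]; omega
      · have := hp p hpv; omega
    · simp only [if_true, ht, List.map_nil, List.sum_nil] at h0 hv
      omega
  · rintro ⟨rfl, rfl, h0, h⟩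
    refine ⟨by simp, by rw [ht_cons, ht_append, h0]; simp [ht], fun p hp hne hpw => ?_⟩
    rcases List.prefix_cons_iff.1 hp with rfl | ⟨t, rfl, ht'⟩
    · exact absurd rfl hne
    · rcases List.prefix_concat_iff.1 ht' with rfl | hv
      · exact absurd rfl hpw
      · have := h t hv
        simp only [ht_cons, if_true]
        omega

theorem sum_ofFn_cons_concat {α M : Type*} [Fintype α] [AddCommMonoid M] (m : ℕ)
    (f : List α → M) :
    ∑ w : Fin (m + 2) → α, f (List.ofFn w) =
      ∑ a, ∑ b, ∑ v : Fin m → α, f (a :: (List.ofFn v ++ [b])) := by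
  rw [← (Fin.consEquiv fun _ : Fin (m + 2) => α).sum_comp, Fintype.sum_prod_type]
  refine Finset.sum_congr rfl fun a _ => ?_
  rw [← (Fin.snocEquiv fun _ : Fin (m + 1) => α).sum_comp, Fintype.sum_prod_type]
  refine Finset.sum_congr rfl fun b _ => Finset.sum_congr rfl fun v _ => ?_
  congr 1
  simp only [Fin.consEquiv, Fin.snocEquiv, Equiv.coe_fn_mk, List.ofFn_cons]
  rw [List.ofFn_succ']
  simp

/-- The combinatorial form of the functional equation `Y(Z) = Z (1 - Y(Z))⁻¹ Zᴴ`
for Ando's unitarization function: `p_{n+1}(Z, Zᴴ) = Z · q_n(Z, Zᴴ) · Zᴴ`. -/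
theorem pMat_succ_eq {d : ℕ} (Z : Matrix (Fin d) (Fin d) ℂ) (n : ℕ) :
    pMat Z (n + 1) = Z * qMat Z n * Zᴴ := by
  have hsum := sum_ofFn_cons_concat (2 * n) (Set.indicator {v | IsIrrDyck v}
    fun v => (v.map (fun b => if b then Z else Zᴴ)).prod)
  rw [pMat, qMat, Finset.mul_sum, Finset.sum_mul]
  refine hsum.trans ?_
  rw [Fintype.sum_bool, Fintype.sum_bool, Fintype.sum_bool]
  classical
  simp only [Set.indicator_apply, Set.mem_ofPred_eq, isIrrDyck_cons_append_singleton_iff]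
  simp [mul_assoc]
end
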